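/- arXiv:0911.1987 — 2 statements merged into one kernel-verified Lean document; each statement's English description precedes it below -/
import Mathlib

section
/- Let A be a 1-Gorenstein artin algebra (the regular modules A_A and _AA have injective dimension ≤ 1). Then the class of finitely generated Gorenstein-projective right A-modules coincides with the class of torsionless modules: Gproj A = sub A. -/
open CategoryTheory Limits

universe u

/-- The `2 × 2` upper triangular matrix algebra `T₂(A)` over a ring `A`,
realized as the subring of `2 × 2` matrices whose lower-left entry vanishes. -/
def T2 (A : Type u) [Ring A] : Subring (Matrix (Fin 2) (Fin 2) A) where
  carrier := {M | M 1 0 = 0}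
  zero_mem' := rfl
  one_mem' := by simp [Matrix.one_apply]
  add_mem' := by intro a b ha hb; simp_all [Set.mem_setOf_eq, Matrix.add_apply]
  neg_mem' := by intro a ha; simp_all [Matrix.neg_apply]
  mul_mem' := by
    intro a b ha hb
    simp only [Set.mem_setOf_eq, Matrix.mul_apply] at *
    rw [Fin.sum_univ_two, ha, hb, zero_mul, mul_zero, add_zero]

/-- A module is torsionless if it embeds into a projective module. -/
def Torsionless {Λ : Type u} [Ring Λ] (M : ModuleCat Λ) : Prop :=
  ∃ (Q : ModuleCat Λ) (f : M ⟶ Q), Projective Q ∧ Mono f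

/-- A totally acyclic complex of (finitely generated) projective `Λ`-modules:
an acyclic complex of projectives which stays acyclic after applying
`Hom_Λ(-, Λ)`. -/
def TotallyAcyclic {Λ : Type u} [Ring Λ] (P : CochainComplex (ModuleCat Λ) ℤ) : Prop :=
  (∀ n, Projective (P.X n) ∧ Module.Finite Λ (P.X n)) ∧
  (∀ i, P.ExactAt i) ∧
  (∀ i, (((preadditiveYoneda.obj (ModuleCat.of Λ Λ)).mapHomologicalComplex
      _).obj P.op).ExactAt i)

/-- A module is Gorenstein-projective if it is the zeroth cocycle of a totally
acyclic complex of projectives. -/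
def GorensteinProjective {Λ : Type u} [Ring Λ] (M : ModuleCat Λ) : Prop :=
  ∃ P : CochainComplex (ModuleCat Λ) ℤ,
    TotallyAcyclic P ∧ Nonempty ((kernel (P.d 0 1)) ≅ M)

/-- The regular module of the ring `Λ` has injective dimension at most `1`:
there is a short exact sequence `0 → Λ → I⁰ → I¹ → 0` with `I⁰, I¹`
injective. -/
def RegularInjDimLE1 (Λ : Type u) [Ring Λ] : Prop :=
  ∃ S : ShortComplex (ModuleCat Λ), S.ShortExact ∧
    Injective S.X₂ ∧ Injective S.X₃ ∧ Nonempty (S.X₁ ≅ ModuleCat.of Λ Λ)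

/-- Concrete form of the injective dimension hypothesis. -/
theorem regInj_concrete (S : Type) [Ring S] (h : RegularInjDimLE1 S) :
    ∃ (I₀ I₁ : ModuleCat.{0} S) (i : S →ₗ[S] I₀) (p : I₀ →ₗ[S] I₁),
      Module.Injective S I₀ ∧ Module.Injective S I₁ ∧ Function.Injective i ∧
      Function.Surjective p ∧ ∀ x, p x = 0 ↔ ∃ s, i s = x := by
  obtain ⟨T, hT, h2, h3, ⟨e⟩⟩ := h
  have h2' : Module.Injective S T.X₂ :=
    @Module.injective_module_of_injective_object S T.X₂ _ _ _ h2
  have h3' : Module.Injective S T.X₃ :=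
    @Module.injective_module_of_injective_object S T.X₃ _ _ _ h3
  have hm := hT.mono_f
  have he := hT.epi_g
  have hinj : Function.Injective T.f := (ModuleCat.mono_iff_injective _).1 hm
  have hsurj : Function.Surjective T.g := (ModuleCat.epi_iff_surjective _).1 he
  have hex := (ShortComplex.moduleCat_exact_iff T).1 hT.exact
  refine ⟨T.X₂, T.X₃, T.f.hom ∘ₗ (e.toLinearEquiv.symm : S →ₗ[S] T.X₁), T.g.hom, h2', h3',
    ?_, hsurj, ?_⟩
  · intro a b hab
    exact e.toLinearEquiv.symm.injective (hinj hab)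
  · intro x
    constructor
    · intro hx
      obtain ⟨y, hy⟩ := hex x hx
      refine ⟨e.toLinearEquiv y, ?_⟩
      show T.f.hom (e.toLinearEquiv.symm (e.toLinearEquiv y)) = x
      rw [LinearEquiv.symm_apply_apply]
      exact hy
    · rintro ⟨s, rfl⟩
      have := T.zero
      have h4 := congrArg (fun t => t.hom (e.toLinearEquiv.symm s)) this
      exact h4

/-- `Ext¹(N, S) = 0` for `N` a submodule of a projective module. -/
theorem extend_of_proj (S : Type) [Ring S] (hS : RegularInjDimLE1 S)
    {X Y F : Type} [AddCommGroup X] [AddCommGroup Y] [AddCommGroup F]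
    [Module S X] [Module S Y] [Module S F] [Module.Projective S F]
    (j : X →ₗ[S] Y) (hj : Function.Injective j) (q : Y →ₗ[S] F)
    (hq : ∀ y, q y = 0 ↔ ∃ x, j x = y) (f : X →ₗ[S] S) :
    ∃ g : Y →ₗ[S] S, ∀ x, g (j x) = f x := by
  obtain ⟨I₀, I₁, i, p, hI₀, hI₁, hi, hp, hip⟩ := regInj_concrete S hS
  obtain ⟨g₀, hg₀⟩ := hI₀.out j hj (i ∘ₗ f)
  have hle : LinearMap.ker q ≤ LinearMap.ker (p ∘ₗ g₀) := by
    intro y hy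
    obtain ⟨x, rfl⟩ := (hq y).1 hy
    rw [LinearMap.mem_ker, LinearMap.comp_apply, hg₀]
    exact (hip _).2 ⟨f x, rfl⟩
  obtain ⟨t, ht⟩ := hI₁.out ((LinearMap.ker q).liftQ q le_rfl)
    (by
      rw [← LinearMap.ker_eq_bot]
      exact Submodule.ker_liftQ_eq_bot _ _ _ le_rfl)
    ((LinearMap.ker q).liftQ (p ∘ₗ g₀) hle)
  have ht' : ∀ y, t (q y) = p (g₀ y) := fun y => by
    have := ht (Submodule.Quotient.mk y)
    simpa using this
  obtain ⟨t', htt⟩ := Module.projective_lifting_property p t hp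
  have htt' : ∀ z, p (t' z) = t z := fun z => by rw [← htt]; rfl
  let g₁ : Y →ₗ[S] I₀ := g₀ - t' ∘ₗ q
  have hg₁ : ∀ y, g₁ y ∈ LinearMap.range i := by
    intro y
    apply (hip _).1
    show p (g₀ y - t' (q y)) = 0
    rw [map_sub, htt', ht', sub_self]
  refine ⟨(LinearEquiv.ofInjective i hi).symm.toLinearMap ∘ₗ g₁.codRestrict _ hg₁, fun x => ?_⟩
  apply (LinearEquiv.ofInjective i hi).injective
  rw [LinearMap.comp_apply, LinearEquiv.coe_coe, LinearEquiv.apply_symm_apply]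
  apply Subtype.ext
  show g₀ (j x) - t' (q (j x)) = i (f x)
  rw [(hq _).2 ⟨x, rfl⟩, hg₀, map_zero, sub_zero]
  rfl

/-- `A` and `Aᵐᵒᵖ` are isomorphic right `A`-modules. -/
def opEq (A : Type) [Ring A] : A ≃ₗ[Aᵐᵒᵖ] Aᵐᵒᵖ where
  toFun := MulOpposite.op
  invFun := MulOpposite.unop
  map_add' _ _ := rfl
  map_smul' _ _ := rfl
  left_inv _ := rfl
  right_inv _ := rfl

/-- Biduality is surjective. -/
theorem bidual_surj (A : Type) [Ring A] [IsNoetherianRing Aᵐᵒᵖ] (hA : RegularInjDimLE1 A)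
    (M : Type) [AddCommGroup M] [Module Aᵐᵒᵖ M] [Module.Finite Aᵐᵒᵖ M]
    (ψ : (M →ₗ[Aᵐᵒᵖ] A) →ₗ[A] A) : ∃ m, ∀ f, ψ f = f m := by
  obtain ⟨k, π, hπ⟩ := Module.Finite.exists_fin' Aᵐᵒᵖ M
  obtain ⟨l, ρ, hρ⟩ := Module.Finite.exists_fin' Aᵐᵒᵖ (LinearMap.ker π)
  let b : Fin k → (Fin k → Aᵐᵒᵖ) := fun i => Pi.single i 1
  have hb : ∀ v : Fin k → Aᵐᵒᵖ, v = ∑ i, v i • b i := fun v => by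
    simpa [b] using (pi_eq_sum_univ' v)
  let r : Fin l → (Fin k → Aᵐᵒᵖ) := fun s => (ρ (Pi.single s 1) : Fin k → Aᵐᵒᵖ)
  -- the dual of the cover
  let j : (M →ₗ[Aᵐᵒᵖ] A) →ₗ[A] (Fin k → A) :=
    { toFun := fun f i => f (π (b i))
      map_add' := fun _ _ => rfl
      map_smul' := fun _ _ => rfl }
  have hM : ∀ m, ∃ v : Fin k → Aᵐᵒᵖ, m = ∑ i, v i • π (b i) := fun m => by
    obtain ⟨v, rfl⟩ := hπ m
    refine ⟨v, ?_⟩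
    conv_lhs => rw [hb v]
    simp
  have hj : Function.Injective j := by
    intro f g hfg
    ext m
    obtain ⟨v, rfl⟩ := hM m
    have h1 : ∀ i, f (π (b i)) = g (π (b i)) := fun i => congrFun hfg i
    simp [h1]
  let q : (Fin k → A) →ₗ[A] (Fin l → A) :=
    { toFun := fun a s => ∑ i, a i * (r s i).unop
      map_add' := fun a c => by ext s; simp [add_mul, Finset.sum_add_distrib]
      map_smul' := fun c a => by ext s; simp [mul_assoc, Finset.mul_sum] }
  have hq : ∀ a, q a = 0 ↔ ∃ f, j f = a := by
    intro a
    constructor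
    · intro ha
      let φ : (Fin k → Aᵐᵒᵖ) →ₗ[Aᵐᵒᵖ] A :=
        { toFun := fun v => ∑ i, a i * (v i).unop
          map_add' := fun v w => by simp [mul_add, Finset.sum_add_distrib]
          map_smul' := fun c v => by simp [← mul_assoc, Finset.sum_mul] }
      have hφr : φ ∘ₗ (LinearMap.ker π).subtype ∘ₗ ρ = 0 := by
        apply LinearMap.pi_ext'
        intro s
        apply LinearMap.ext_ring
        exact congrFun ha s
      have hle : LinearMap.ker π ≤ LinearMap.ker φ := by
        intro v hv
        obtain ⟨w, hw⟩ := hρ ⟨v, hv⟩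
        have := LinearMap.congr_fun hφr w
        simp only [LinearMap.comp_apply, hw] at this
        exact this
      let e := π.quotKerEquivOfSurjective hπ
      refine ⟨((LinearMap.ker π).liftQ φ hle) ∘ₗ e.symm.toLinearMap, ?_⟩
      ext i
      show (LinearMap.ker π).liftQ φ hle (e.symm (π (b i))) = a i
      have : e.symm (π (b i)) = Submodule.Quotient.mk (b i) := by
        rw [LinearEquiv.symm_apply_eq]; rfl
      rw [this, Submodule.liftQ_apply]
      show ∑ i', a i' * ((b i) i').unop = a i
      rw [Finset.sum_eq_single i]
      · simp [b]
      · intro c _ hc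
        simp [b, hc]
      · simp
    · rintro ⟨f, rfl⟩
      ext s
      show ∑ i, f (π (b i)) * (r s i).unop = 0
      have h0 : π (r s) = 0 := (ρ (Pi.single s 1)).2
      have h1 : f (π (r s)) = ∑ i, f (π (b i)) * (r s i).unop := by
        conv_lhs => rw [hb (r s)]
        simp only [map_sum, map_smul]
        rfl
      rw [← h1, h0, map_zero]
  obtain ⟨g, hg⟩ := extend_of_proj A hA j hj q hq ψ
  refine ⟨∑ i, MulOpposite.op (g (Pi.single i 1)) • π (b i), fun f => ?_⟩
  rw [← hg f]
  have : j f = ∑ i, (j f i) • (Pi.single i (1 : A) : Fin k → A) := by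
    simpa using (pi_eq_sum_univ' (j f))
  rw [this]
  simp only [map_sum, map_smul]
  rfl

/-- Homomorphisms to the regular module separate points. -/
def SepPts (A : Type) [Ring A] (M : Type) [AddCommGroup M] [Module Aᵐᵒᵖ M] : Prop :=
  ∀ m : M, (∀ f : M →ₗ[Aᵐᵒᵖ] A, f m = 0) → m = 0

instance projPi (A : Type) [Ring A] (n : ℕ) : Module.Projective Aᵐᵒᵖ (Fin n → A) :=
  Module.Projective.of_equiv (LinearEquiv.piCongrRight (fun _ : Fin n => (opEq A).symm))

instance finPi (A : Type) [Ring A] (n : ℕ) : Module.Finite Aᵐᵒᵖ (Fin n → A) :=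
  Module.Finite.equiv (LinearEquiv.piCongrRight (fun _ : Fin n => (opEq A).symm))

theorem dual_finite (A : Type) [Ring A] [IsNoetherianRing A]
    (M : Type) [AddCommGroup M] [Module Aᵐᵒᵖ M] [Module.Finite Aᵐᵒᵖ M] :
    Module.Finite A (M →ₗ[Aᵐᵒᵖ] A) := by
  obtain ⟨k, s, hs⟩ := Module.Finite.exists_fin (R := Aᵐᵒᵖ) (M := M)
  let j : (M →ₗ[Aᵐᵒᵖ] A) →ₗ[A] (Fin k → A) :=
    { toFun := fun f i => f (s i)
      map_add' := fun _ _ => rfl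
      map_smul' := fun _ _ => rfl }
  refine Module.Finite.of_injective j ?_
  intro f g hfg
  apply LinearMap.ext_on_range hs
  intro i
  exact congrFun hfg i

/-- Left approximation. -/
theorem approx (A : Type) [Ring A] [IsNoetherianRing A]
    (M : Type) [AddCommGroup M] [Module Aᵐᵒᵖ M] [Module.Finite Aᵐᵒᵖ M] (hM : SepPts A M) :
    ∃ (n : ℕ) (φ : Fin n → (M →ₗ[Aᵐᵒᵖ] A)),
      Function.Injective (LinearMap.pi φ) ∧ Submodule.span A (Set.range φ) = ⊤ := by
  have := dual_finite A M
  obtain ⟨n, φ, hφ⟩ := Module.Finite.exists_fin (R := A) (M := M →ₗ[Aᵐᵒᵖ] A)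
  refine ⟨n, φ, ?_, hφ⟩
  rw [injective_iff_map_eq_zero]
  intro m hm
  apply hM
  intro f
  have hf : f ∈ Submodule.span A (Set.range φ) := hφ ▸ Submodule.mem_top
  induction hf using Submodule.span_induction with
  | mem x hx => obtain ⟨i, rfl⟩ := hx; exact congrFun hm i
  | zero => rfl
  | add x y _ _ hx hy => simp [hx, hy]
  | smul a x _ hx => simp [hx]

theorem coker_sep (A : Type) [Ring A] [IsNoetherianRing Aᵐᵒᵖ] (hA : RegularInjDimLE1 A)
    (M : Type) [AddCommGroup M] [Module Aᵐᵒᵖ M] [Module.Finite Aᵐᵒᵖ M]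
    (n : ℕ) (φ : Fin n → (M →ₗ[Aᵐᵒᵖ] A)) (hφ : Submodule.span A (Set.range φ) = ⊤) :
    SepPts A ((Fin n → A) ⧸ LinearMap.range (LinearMap.pi φ)) := by
  intro c hc
  obtain ⟨v, rfl⟩ := Submodule.Quotient.mk_surjective _ c
  let σ : (Fin n → A) →ₗ[A] (M →ₗ[Aᵐᵒᵖ] A) := Fintype.linearCombination A φ
  have hσ : Function.Surjective σ := by
    rw [← LinearMap.range_eq_top, Fintype.range_linearCombination, hφ]
  let τ : (Fin n → A) →ₗ[A] A := Fintype.linearCombination A v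
  have hle : LinearMap.ker σ ≤ LinearMap.ker τ := by
    intro a ha
    let φa : (Fin n → A) →ₗ[Aᵐᵒᵖ] A :=
        { toFun := fun w => ∑ i, a i * w i
          map_add' := fun v w => by simp [mul_add, Finset.sum_add_distrib]
          map_smul' := fun c v => by simp [← mul_assoc, Finset.sum_mul] }
    have h1 : LinearMap.range (LinearMap.pi φ) ≤ LinearMap.ker φa := by
      rintro _ ⟨m, rfl⟩
      have : σ a m = 0 := by rw [LinearMap.mem_ker.1 ha]; rfl
      rw [LinearMap.mem_ker, ← this]
      simp [σ, φa, Fintype.linearCombination_apply]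
    have h2 := hc ((LinearMap.range (LinearMap.pi φ)).liftQ φa h1)
    rw [Submodule.liftQ_apply] at h2
    rw [LinearMap.mem_ker, ← h2]
    simp [τ, φa, Fintype.linearCombination_apply]
  let e := σ.quotKerEquivOfSurjective hσ
  obtain ⟨m, hm⟩ := bidual_surj A hA M ((LinearMap.ker σ).liftQ τ hle ∘ₗ e.symm.toLinearMap)
  rw [Submodule.Quotient.mk_eq_zero]
  refine ⟨m, ?_⟩
  ext i
  have h3 := hm (σ (Pi.single i 1))
  have h4 : e.symm (σ (Pi.single i 1)) = Submodule.Quotient.mk (Pi.single i 1) := by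
    rw [LinearEquiv.symm_apply_eq]; rfl
  rw [LinearMap.comp_apply, LinearEquiv.coe_coe, h4, Submodule.liftQ_apply] at h3
  have h5 : σ (Pi.single i 1) = φ i := by simp [σ, Fintype.linearCombination_apply_single]
  have h6 : τ (Pi.single i 1) = v i := by simp [τ, Fintype.linearCombination_apply_single]
  rw [h5, h6] at h3
  exact h3.symm

/-- `Ext¹(N, A) = 0` for `N` finitely generated torsionless. -/
theorem extend_of_sep (A : Type) [Ring A] [IsNoetherianRing A] (hA : RegularInjDimLE1 Aᵐᵒᵖ)
    {X Y N : Type} [AddCommGroup X] [AddCommGroup Y] [AddCommGroup N]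
    [Module Aᵐᵒᵖ X] [Module Aᵐᵒᵖ Y] [Module Aᵐᵒᵖ N] [Module.Finite Aᵐᵒᵖ N] (hN : SepPts A N)
    (j : X →ₗ[Aᵐᵒᵖ] Y) (hj : Function.Injective j) (q : Y →ₗ[Aᵐᵒᵖ] N)
    (hq : ∀ y, q y = 0 ↔ ∃ x, j x = y) (f : X →ₗ[Aᵐᵒᵖ] Aᵐᵒᵖ) :
    ∃ g : Y →ₗ[Aᵐᵒᵖ] Aᵐᵒᵖ, ∀ x, g (j x) = f x := by
  obtain ⟨n, φ, hφ, -⟩ := approx A N hN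
  refine extend_of_proj Aᵐᵒᵖ hA j hj (LinearMap.pi φ ∘ₗ q) (fun y => ?_) f
  rw [← hq, LinearMap.comp_apply, map_eq_zero_iff _ hφ]

theorem sep_of_torsionless (A : Type) [Ring A] (M : ModuleCat.{0} Aᵐᵒᵖ) (h : Torsionless M) :
    SepPts A M := by
  obtain ⟨Q, f, hQ, hf⟩ := h
  have hQ' : Module.Projective Aᵐᵒᵖ Q := (IsProjective.iff_projective Q).2 hQ
  have hf' : Function.Injective f := (ModuleCat.mono_iff_injective _).1 hf
  obtain ⟨s, hs⟩ := hQ'.out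
  intro m hm
  apply (injective_iff_map_eq_zero f.hom).1 hf'
  apply (injective_iff_map_eq_zero s).1 hs.injective
  ext x
  exact congrArg MulOpposite.op
    (hm ((opEq A).symm.toLinearMap ∘ₗ Finsupp.lapply x ∘ₗ s ∘ₗ f.hom))

theorem int_chain {α : Type*} (r : α → α → Prop) (hf : ∀ a, ∃ b, r a b) (hb : ∀ a, ∃ b, r b a)
    (a : α) : ∃ Z : ℤ → α, Z 0 = a ∧ ∀ i, r (Z i) (Z (i + 1)) := by
  choose f hf using hf
  choose g hg using hb
  refine ⟨fun i => match i with
    | Int.ofNat n => f^[n] a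
    | Int.negSucc n => g^[n + 1] a, rfl, ?_⟩
  intro i
  match i with
  | Int.ofNat n =>
    show r (f^[n] a) (f^[n + 1] a)
    rw [Function.iterate_succ_apply']
    exact hf _
  | Int.negSucc 0 => exact hg a
  | Int.negSucc (n + 1) =>
    show r (g^[n + 1 + 1] a) (g^[n + 1] a)
    rw [Function.iterate_succ_apply' g (n + 1)]
    exact hg _

/-- There is a short exact sequence `0 → X → Aⁿ → Y → 0`. -/
def StepRel (A : Type) [Ring A] (X Y : ModuleCat.{0} Aᵐᵒᵖ) : Prop :=
  ∃ (n : ℕ) (i : X →ₗ[Aᵐᵒᵖ] (Fin n → A)) (p : (Fin n → A) →ₗ[Aᵐᵒᵖ] Y),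
    Function.Injective i ∧ Function.Surjective p ∧ ∀ v, p v = 0 ↔ ∃ x, i x = v

theorem step_fwd (A : Type) [Ring A] [IsNoetherianRing A] [IsNoetherianRing Aᵐᵒᵖ]
    (hA : RegularInjDimLE1 A) (M : ModuleCat.{0} Aᵐᵒᵖ) (h1 : Module.Finite Aᵐᵒᵖ M)
    (h2 : SepPts A M) :
    ∃ N : ModuleCat.{0} Aᵐᵒᵖ, (Module.Finite Aᵐᵒᵖ N ∧ SepPts A N) ∧ StepRel A M N := by
  obtain ⟨n, φ, hinj, hspan⟩ := approx A M h2
  refine ⟨ModuleCat.of Aᵐᵒᵖ ((Fin n → A) ⧸ LinearMap.range (LinearMap.pi φ)),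
    ⟨inferInstanceAs (Module.Finite Aᵐᵒᵖ ((Fin n → A) ⧸ LinearMap.range (LinearMap.pi φ))),
      coker_sep A hA M n φ hspan⟩, n, LinearMap.pi φ, Submodule.mkQ _, hinj,
      Submodule.mkQ_surjective _, fun v => ?_⟩
  exact Submodule.Quotient.mk_eq_zero _

theorem step_bwd (A : Type) [Ring A] [IsNoetherianRing Aᵐᵒᵖ]
    (M : ModuleCat.{0} Aᵐᵒᵖ) (h1 : Module.Finite Aᵐᵒᵖ M) :
    ∃ N : ModuleCat.{0} Aᵐᵒᵖ, (Module.Finite Aᵐᵒᵖ N ∧ SepPts A N) ∧ StepRel A N M := by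
  obtain ⟨n, π, hπ⟩ := Module.Finite.exists_fin' Aᵐᵒᵖ M
  let e : (Fin n → A) ≃ₗ[Aᵐᵒᵖ] (Fin n → Aᵐᵒᵖ) :=
    LinearEquiv.piCongrRight (fun _ : Fin n => opEq A)
  let p : (Fin n → A) →ₗ[Aᵐᵒᵖ] M := π ∘ₗ e.toLinearMap
  have : IsNoetherian Aᵐᵒᵖ (Fin n → A) := isNoetherian_of_isNoetherianRing_of_finite _ _
  refine ⟨ModuleCat.of Aᵐᵒᵖ (LinearMap.ker p),
    ⟨inferInstanceAs (Module.Finite Aᵐᵒᵖ (LinearMap.ker p)), ?_⟩,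
    n, (LinearMap.ker p).subtype, p, Subtype.val_injective, hπ.comp e.surjective, fun v => ?_⟩
  · intro m hm
    apply Subtype.ext
    ext i
    exact hm (LinearMap.proj i ∘ₗ (LinearMap.ker p).subtype)
  · constructor
    · intro hv
      exact ⟨⟨v, hv⟩, rfl⟩
    · rintro ⟨x, rfl⟩
      exact x.2

theorem gproj_of_sep (A : Type) [Ring A] [IsNoetherianRing A] [IsNoetherianRing Aᵐᵒᵖ]
    (hr : RegularInjDimLE1 Aᵐᵒᵖ) (hl : RegularInjDimLE1 A) (M : ModuleCat.{0} Aᵐᵒᵖ)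
    (h1 : Module.Finite Aᵐᵒᵖ M) (h2 : SepPts A M) : GorensteinProjective M := by
  obtain ⟨Z, hZ0, hZ⟩ := int_chain
    (α := {N : ModuleCat.{0} Aᵐᵒᵖ // Module.Finite Aᵐᵒᵖ N ∧ SepPts A N})
    (fun X Y => StepRel A X.1 Y.1)
    (fun X => by
      obtain ⟨N, hN, hs⟩ := step_fwd A hl X.1 X.2.1 X.2.2
      exact ⟨⟨N, hN⟩, hs⟩)
    (fun X => by
      obtain ⟨N, hN, hs⟩ := step_bwd A X.1 X.2.1
      exact ⟨⟨N, hN⟩, hs⟩)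
    ⟨M, h1, h2⟩
  choose n i p hi hp hip using hZ
  let X : ℤ → ModuleCat.{0} Aᵐᵒᵖ := fun k => ModuleCat.of Aᵐᵒᵖ (Fin (n k) → A)
  let d : ∀ k, X k ⟶ X (k + 1) := fun k => ModuleCat.ofHom (i (k + 1) ∘ₗ p k)
  have hd : ∀ k v, (d k).hom v = i (k + 1) (p k v) := fun _ _ => rfl
  have pi0 : ∀ k x, p k (i k x) = 0 := fun k x => (hip k _).2 ⟨x, rfl⟩
  let P : CochainComplex (ModuleCat.{0} Aᵐᵒᵖ) ℤ := CochainComplex.of X d (fun k => by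
    refine ModuleCat.hom_ext (LinearMap.ext fun v => ?_)
    show i (k + 1 + 1) (p (k + 1) (i (k + 1) (p k v))) = 0
    rw [pi0, map_zero])
  have hPd : ∀ k, P.d k (k + 1) = d k := fun k => CochainComplex.of_d X d k
  refine ⟨P, ⟨fun k => ⟨?_, ?_⟩, ?_, ?_⟩, ?_⟩
  · exact (IsProjective.iff_projective _).1 (projPi A (n k))
  · exact finPi A (n k)
  · intro k
    obtain ⟨k, rfl⟩ : ∃ k', k = k' + 1 := ⟨k - 1, by ring⟩
    rw [HomologicalComplex.exactAt_iff' P k (k + 1) (k + 1 + 1) (by simp) (by simp),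
      ShortComplex.moduleCat_exact_iff]
    show ∀ x : X (k + 1), (P.d (k + 1) (k + 1 + 1)).hom x = 0 → ∃ y, (P.d k (k + 1)).hom y = x
    rw [hPd, hPd]
    intro x hx
    rw [hd, map_eq_zero_iff _ (hi _)] at hx
    obtain ⟨z, rfl⟩ := (hip _ _).1 hx
    obtain ⟨y, rfl⟩ := hp _ z
    exact ⟨y, rfl⟩
  · intro k
    obtain ⟨k, rfl⟩ : ∃ k', k = k' + 1 := ⟨k - 1, by ring⟩
    rw [HomologicalComplex.exactAt_iff' _ (k + 1 + 1) (k + 1) k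
      (ComplexShape.prev_eq' _ (rfl : k + 1 + 1 = k + 1 + 1))
      (ComplexShape.next_eq' _ (rfl : k + 1 = k + 1)),
      ShortComplex.ab_exact_iff]
    show ∀ φ : X (k + 1) ⟶ ModuleCat.of Aᵐᵒᵖ Aᵐᵒᵖ, P.d k (k + 1) ≫ φ = 0 →
      ∃ ψ : X (k + 1 + 1) ⟶ ModuleCat.of Aᵐᵒᵖ Aᵐᵒᵖ, P.d (k + 1) (k + 1 + 1) ≫ ψ = φ
    rw [hPd, hPd]
    intro φ hφ
    have hφ0 : ∀ z, φ.hom (i (k + 1) z) = 0 := fun z => by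
      obtain ⟨y, rfl⟩ := hp k z
      exact congrArg (fun t => t.hom y) hφ
    have hle : LinearMap.ker (p (k + 1)) ≤ LinearMap.ker φ.hom := by
      intro v hv
      obtain ⟨z, rfl⟩ := (hip _ _).1 hv
      exact hφ0 z
    let e := (p (k + 1)).quotKerEquivOfSurjective (hp (k + 1))
    have := (Z (k + 1 + 1 + 1)).2.1
    obtain ⟨g, hg⟩ := extend_of_sep A hr (Z (k + 1 + 1 + 1)).2.2 (i (k + 1 + 1)) (hi _)
      (p (k + 1 + 1)) (hip _) ((LinearMap.ker (p (k + 1))).liftQ φ.hom hle ∘ₗ e.symm.toLinearMap)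
    refine ⟨ModuleCat.ofHom g, ?_⟩
    refine ModuleCat.hom_ext (LinearMap.ext fun v => ?_)
    show g (i (k + 1 + 1) (p (k + 1) v)) = φ.hom v
    rw [hg, LinearMap.comp_apply, LinearEquiv.coe_coe]
    have h4 : e.symm (p (k + 1) v) = Submodule.Quotient.mk v := by
      rw [LinearEquiv.symm_apply_eq]; rfl
    rw [h4, Submodule.liftQ_apply]
  · have hM : (Z 0).1 = M := by rw [hZ0]
    rw [← hM]
    have hk : LinearMap.ker (P.d 0 1).hom = LinearMap.range (i 0) := by
      have h01 : P.d 0 1 = d 0 := hPd 0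
      rw [h01]
      ext v
      rw [LinearMap.mem_ker, hd, map_eq_zero_iff _ (hi _), hip]
      rfl
    exact ⟨ModuleCat.kernelIsoKer (P.d 0 1) ≪≫
      ((LinearEquiv.ofEq _ _ hk).trans (LinearEquiv.ofInjective (i 0) (hi 0)).symm).toModuleIso⟩

/-- Let `A` be a `1`-Gorenstein artin algebra (both regular
modules `A_A` and `_A A` have injective dimension `≤ 1`). Then a finitely
generated right `A`-module (= left `Aᵐᵒᵖ`-module) is Gorenstein-projective if
and only if it is torsionless: `Gproj A = sub A`. -/
theorem stmt14 (R : Type) [CommRing R] [IsArtinianRing R]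
    (A : Type) [Ring A] [Algebra R A] [Module.Finite R A]
    (hinj_right : RegularInjDimLE1 Aᵐᵒᵖ)
    (hinj_left : RegularInjDimLE1 A)
    (M : ModuleCat.{0} Aᵐᵒᵖ) [Module.Finite Aᵐᵒᵖ M] :
    GorensteinProjective M ↔ Torsionless M := by
  have h1 : IsNoetherianRing Aᵐᵒᵖ := IsNoetherianRing.of_finite R _
  have h2 : IsNoetherianRing A := IsNoetherianRing.of_finite R _
  constructor
  · rintro ⟨P, ⟨hP, -, -⟩, ⟨e⟩⟩
    exact ⟨P.X 0, e.inv ≫ kernel.ι _, (hP 0).1, inferInstance⟩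
  · intro h
    exact gproj_of_sep A hinj_right hinj_left M inferInstance (sep_of_torsionless A M h)
end

section
/- Let A be a self-injective artin algebra. Under the equivalence mod T₂(A) ≃ Mor(mod A), the torsionless T₂(A)-modules correspond exactly to the monomorphisms of A-modules; that is, sub T₂(A) corresponds to Mon(mod A). -/
open CategoryTheory Limits

universe u

namespace QF
section
variable {B : Type} [Ring B]

/-- Two simple modules, one killed by the annihilators of finitely many elements of the other. -/
theorem iso_of_finset {S U : Type} [AddCommGroup S] [Module B S] [AddCommGroup U] [Module B U]
    [IsSimpleModule B S] [IsSimpleModule B U] (u : U) (hu : u ≠ 0) (t : Finset S)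
    (h : ∀ b : B, (∀ s ∈ t, b • s = 0) → b • u = 0) : Nonempty (S ≃ₗ[B] U) := by
  classical
  induction t using Finset.induction_on with
  | empty => exact absurd (by simpa using h 1 (by simp)) hu
  | insert s t hs ih =>
    by_cases h1 : ∀ b : B, (∀ s ∈ t, b • s = 0) → b • u = 0
    · exact ih h1
    · push Not at h1
      obtain ⟨b0, hb0, hbu⟩ := h1
      let L : Submodule B B := ⨅ s ∈ t, LinearMap.ker (LinearMap.toSpanSingleton B S s)
      have hL : ∀ b, b ∈ L ↔ ∀ s ∈ t, b • s = 0 := by intro b; simp [L]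
      let f : L →ₗ[B] S := (LinearMap.toSpanSingleton B S s).comp L.subtype
      let g : L →ₗ[B] U := (LinearMap.toSpanSingleton B U u).comp L.subtype
      have hg : g ≠ 0 := fun hg => hbu (by
        have := LinearMap.congr_fun hg ⟨b0, (hL b0).2 hb0⟩
        simpa [g] using this)
      have hfg : LinearMap.ker f ≤ LinearMap.ker g := by
        rintro ⟨b, hb⟩ hbf
        rw [hL] at hb
        have hbf : b • s = 0 := by simpa [f] using hbf
        have : b • u = 0 := h b (by
          intro x hx
          rcases Finset.mem_insert.1 hx with rfl | hx
          · exact hbf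
          · exact hb x hx)
        simpa [g] using this
      have hf : f ≠ 0 := by
        rintro hf
        apply hg
        rw [← LinearMap.ker_eq_top] at hf ⊢
        exact top_le_iff.1 (hf ▸ hfg)
      have sf := LinearMap.surjective_of_ne_zero hf
      have sg := LinearMap.surjective_of_ne_zero hg
      have cf := LinearMap.isCoatom_ker_of_surjective sf
      have cg := LinearMap.isCoatom_ker_of_surjective sg
      have he : LinearMap.ker f = LinearMap.ker g := (cf.le_iff.1 hfg).resolve_left cg.1 |>.symm
      exact ⟨(f.quotKerEquivOfSurjective sf).symm ≪≫ₗ Submodule.quotEquivOfEq _ _ he ≪≫ₗ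
        g.quotKerEquivOfSurjective sg⟩

theorem iso_of_ann [IsArtinianRing B] {S U : Type} [AddCommGroup S] [Module B S] [AddCommGroup U]
    [Module B U] [IsSimpleModule B S] [IsSimpleModule B U]
    (h : Module.annihilator B S ≤ Module.annihilator B U) : Nonempty (S ≃ₗ[B] U) := by
  classical
  have := IsSimpleModule.nontrivial B U
  obtain ⟨u, hu⟩ := exists_ne (0 : U)
  let F : Finset S → Submodule B B := fun t => ⨅ s ∈ t, LinearMap.ker (LinearMap.toSpanSingleton B S s)
  have hF : ∀ t b, b ∈ F t ↔ ∀ s ∈ t, b • s = 0 := by intro t b; simp [F]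
  obtain ⟨_, ⟨t, rfl⟩, ht⟩ := IsArtinian.set_has_minimal (Set.range F) ⟨_, ⟨∅, rfl⟩⟩
  refine iso_of_finset u hu t fun b hb => ?_
  refine Module.mem_annihilator.1 (h ?_) u
  rw [Module.mem_annihilator]
  intro s
  have h1 := ht (F (insert s t)) ⟨_, rfl⟩
  have h2 : F (insert s t) ≤ F t := by
    intro b hb
    rw [hF] at hb ⊢
    exact fun x hx => hb x (Finset.mem_insert_of_mem hx)
  have h3 : F t ≤ F (insert s t) := by
    by_contra hn
    exact h1 (lt_of_le_not_ge h2 hn)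
  exact (hF _ _).1 (h3 ((hF _ _).2 hb)) s (Finset.mem_insert_self _ _)

theorem exists_simple [IsArtinianRing B] {M : Type} [AddCommGroup M] [Module B M]
    (N : Submodule B M) (hN : N ≠ ⊥) : ∃ T : Submodule B M, T ≤ N ∧ IsSimpleModule B T := by
  obtain ⟨x, hx, hx0⟩ := Submodule.exists_mem_ne_zero_of_ne_bot hN
  let C := Submodule.span B {x}
  have : IsArtinian B C := isArtinian_of_fg_of_artinian _ (Submodule.fg_span_singleton x)
  have hC : (⊤ : Submodule B C) ≠ ⊥ := by
    intro h
    have : (⟨x, Submodule.mem_span_singleton_self x⟩ : C) ∈ (⊤ : Submodule B C) := trivial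
    rw [h, Submodule.mem_bot] at this
    exact hx0 (congrArg Subtype.val this)
  obtain ⟨T, hT, -⟩ := (eq_bot_or_exists_atom_le (⊤ : Submodule B C)).resolve_left hC
  have := isSimpleModule_iff_isAtom.2 hT
  refine ⟨T.map C.subtype, ?_, ?_⟩
  · exact (Submodule.map_subtype_le _ _).trans (by simpa [C] using hx)
  · exact IsSimpleModule.congr (Submodule.equivSubtypeMap C T).symm

theorem artinian (R : Type) [CommRing R] [IsArtinianRing R] [Algebra R B] [Module.Finite R B]
    : IsArtinianRing B := isArtinian_of_tower R inferInstance

theorem exists_left_ann (R : Type) [CommRing R] [IsArtinianRing R] [Algebra R B] [Module.Finite R B]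
    (hB : Module.Injective B B) (I : Ideal B) (hI : (1 : B) ∉ I)
    (h2 : ∀ x ∈ I, ∀ b, x * b ∈ I) :
    ∃ x : B, x ≠ 0 ∧ ∀ a ∈ I, x * a = 0 := by
  by_contra! hc
  have hfg : (I.restrictScalars R).FG := IsNoetherian.noetherian _
  obtain ⟨n, v, hv⟩ := Submodule.fg_iff_exists_fin_generating_family.1 hfg
  let f : B →ₗ[B] (Fin n → B) := LinearMap.pi fun i => LinearMap.toSpanSingleton B B (v i)
  have hvI : ∀ i, v i ∈ I := fun i => by
    have : v i ∈ I.restrictScalars R := hv ▸ Submodule.subset_span ⟨i, rfl⟩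
    exact this
  have hf : Function.Injective f := by
    rw [injective_iff_map_eq_zero]
    intro x hx
    by_contra hx0
    obtain ⟨a, ha, hxa⟩ := hc x hx0
    apply hxa
    have : I.restrictScalars R ≤ LinearMap.ker (LinearMap.mulLeft R x) := by
      rw [← hv, Submodule.span_le]
      rintro _ ⟨i, rfl⟩
      have := congrFun hx i
      simpa [f] using this
    simpa using this (show a ∈ I.restrictScalars R from ha)
  obtain ⟨g, hg⟩ := hB.out f hf LinearMap.id
  have h1 := hg 1
  have : f 1 = ∑ i, v i • (Pi.single i 1 : Fin n → B) := by
    ext j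
    simp [f, Finset.sum_apply, Pi.single_apply]
  rw [this, map_sum] at h1
  apply hI
  rw [show (1 : B) = LinearMap.id (R := B) (1 : B) from rfl, ← h1]
  refine Submodule.sum_mem _ fun i _ => ?_
  rw [map_smul]
  exact h2 _ (hvI i) _

/-- The step of the Nakayama permutation. -/
theorem exists_step (R : Type) [CommRing R] [IsArtinianRing R] [Algebra R B] [Module.Finite R B]
    (hB : Module.Injective B B) (m : Ideal B) [IsSimpleModule B (B ⧸ m)] :
    ∃ x : B, (∀ a ∈ Module.annihilator B (B ⧸ m), x * a = 0) ∧
      IsSimpleModule B (B ⧸ LinearMap.ker (LinearMap.toSpanSingleton B B x)) := by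
  have := artinian (B := B) R
  have := IsSimpleModule.nontrivial B (B ⧸ m)
  set I := Module.annihilator B (B ⧸ m) with hI
  have h1 : (1 : B) ∉ I := by
    intro h
    rw [hI, ← Ideal.eq_top_iff_one, Module.annihilator_eq_top_iff] at h
    exact not_subsingleton _ h
  obtain ⟨x0, hx0, hx0I⟩ := exists_left_ann R hB I h1 (fun x hx b => I.mul_mem_right b hx)
  let N : Submodule B B :=
    { carrier := {x | ∀ a ∈ I, x * a = 0}
      zero_mem' := by simp
      add_mem' := fun {x y} hx hy a ha => by rw [add_mul, hx a ha, hy a ha, add_zero]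
      smul_mem' := fun c x hx a ha => by rw [smul_eq_mul, mul_assoc, hx a ha, mul_zero] }
  have hN : N ≠ ⊥ := fun h => hx0 (by
    have : x0 ∈ N := hx0I
    rwa [h, Submodule.mem_bot] at this)
  obtain ⟨T, hTN, hT⟩ := exists_simple N hN
  have := IsSimpleModule.nontrivial B T
  obtain ⟨⟨x, hxT⟩, hx⟩ := exists_ne (0 : T)
  refine ⟨x, hTN hxT, ?_⟩
  have := IsSimpleModule.ker_toSpanSingleton_isMaximal B hx
  rw [isSimpleModule_iff_isCoatom]
  convert this.out using 1
  ext b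
  simp [Subtype.ext_iff]

theorem step_inj [IsArtinianRing B] (hB : Module.Injective B B) (m n : Ideal B)
    [IsSimpleModule B (B ⧸ m)] [IsSimpleModule B (B ⧸ n)] (x y : B)
    (hx : ∀ a ∈ Module.annihilator B (B ⧸ m), x * a = 0)
    (hy : ∀ a ∈ Module.annihilator B (B ⧸ n), y * a = 0) 
    [hys : IsSimpleModule B (B ⧸ LinearMap.ker (LinearMap.toSpanSingleton B B y))]
    (e : (B ⧸ LinearMap.ker (LinearMap.toSpanSingleton B B x)) ≃ₗ[B]
      (B ⧸ LinearMap.ker (LinearMap.toSpanSingleton B B y))) :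
    Nonempty ((B ⧸ m) ≃ₗ[B] (B ⧸ n)) := by
  let j := (LinearMap.toSpanSingleton B B x).quotKerEquivRange
  let k := (LinearMap.toSpanSingleton B B y).quotKerEquivRange
  let i := (LinearMap.range (LinearMap.toSpanSingleton B B x)).subtype
  let f : (LinearMap.range (LinearMap.toSpanSingleton B B x)) →ₗ[B] B :=
    (LinearMap.range (LinearMap.toSpanSingleton B B y)).subtype.comp
      (j.symm ≪≫ₗ e ≪≫ₗ k).toLinearMap
  obtain ⟨g, hg⟩ := hB.out i (Submodule.subtype_injective _) f
  let x' : LinearMap.range (LinearMap.toSpanSingleton B B x) := ⟨x, ⟨1, by simp⟩⟩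
  -- the element `z` lies in both annihilators
  let z := f x'
  have hfinj : Function.Injective f := by
    intro a b hab
    exact (j.symm ≪≫ₗ e ≪≫ₗ k).injective (Subtype.ext hab)
  have hz0 : z ≠ 0 := by
    intro hz
    have : x' = 0 := hfinj (by rw [map_zero]; exact hz)
    have hx0 : x = 0 := congrArg Subtype.val this
    have hsub : Subsingleton (B ⧸ LinearMap.ker (LinearMap.toSpanSingleton B B x)) := by
      rw [Submodule.Quotient.subsingleton_iff, LinearMap.ker_eq_top, hx0]
      ext; simp
    have := IsSimpleModule.nontrivial B (B ⧸ LinearMap.ker (LinearMap.toSpanSingleton B B y))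
    have := e.symm.toEquiv.subsingleton
    exact not_subsingleton (B ⧸ LinearMap.ker (LinearMap.toSpanSingleton B B y)) this
  have hz1 : z = x * g 1 := by
    have := hg x'
    rw [← show g (i x') = z from this, show i x' = x • (1 : B) by simp [i, x'], map_smul]; rfl
  obtain ⟨c, hc⟩ : ∃ c, z = c * y := by
    obtain ⟨c, hc⟩ := ((j.symm ≪≫ₗ e ≪≫ₗ k) x').2
    exact ⟨c, hc.symm⟩
  by_contra hne
  have htop : Module.annihilator B (B ⧸ m) ⊔ Module.annihilator B (B ⧸ n) = ⊤ := by
    by_contra hnt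
    obtain ⟨p, hp, hle⟩ := Ideal.exists_le_maximal _ hnt
    have : IsSimpleModule B (B ⧸ p) := isSimpleModule_iff_isCoatom.2 hp.out
    have key : ∀ J : Ideal B, J.IsTwoSided → J ≤ p → J ≤ Module.annihilator B (B ⧸ p) := by
      intro J hJ hJp a ha
      rw [Module.mem_annihilator]
      intro q
      obtain ⟨b, rfl⟩ := Submodule.Quotient.mk_surjective _ q
      rw [← Submodule.Quotient.mk_smul, Submodule.Quotient.mk_eq_zero]
      exact hJp (J.mul_mem_right b ha)
    obtain ⟨e1⟩ := iso_of_ann (key _ inferInstance (le_sup_left.trans hle))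
    obtain ⟨e2⟩ := iso_of_ann (key _ inferInstance (le_sup_right.trans hle))
    exact hne ⟨e1 ≪≫ₗ e2.symm⟩
  obtain ⟨a, ha, b, hb, hab⟩ := Submodule.mem_sup.1 (htop ▸ Submodule.mem_top : (1 : B) ∈ _)
  apply hz0
  rw [← mul_one z, ← hab, mul_add]
  nth_rw 1 [hz1]
  rw [hc, mul_assoc, hx _ (Ideal.mul_mem_left _ _ ha), mul_assoc, hy _ hb, mul_zero, add_zero]

theorem exists_mem_ann [IsArtinianRing B] {U : Type} [AddCommGroup U] [Module B U] 
    [IsSimpleModule B U] (S : ℕ → Type)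
    [∀ i, AddCommGroup (S i)] [∀ i, Module B (S i)] [∀ i, IsSimpleModule B (S i)]
    (k : ℕ) (h : ∀ i < k, IsEmpty (S i ≃ₗ[B] U)) :
    ∃ a : B, (∀ i < k, a ∈ Module.annihilator B (S i)) ∧ ∃ u : U, a • u ≠ 0 := by
  induction k with
  | zero =>
    have := IsSimpleModule.nontrivial B U
    obtain ⟨u, hu⟩ := exists_ne (0 : U)
    exact ⟨1, by simp, u, by simpa⟩
  | succ k ih =>
    obtain ⟨a, ha, u, hu⟩ := ih fun i hi => h i (by omega)
    have : ¬ Module.annihilator B (S k) ≤ Module.annihilator B U := fun hle =>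
      (h k (by omega)).elim (iso_of_ann hle).some
    obtain ⟨c, hc, hcU⟩ := SetLike.not_le_iff_exists.1 this
    rw [Module.mem_annihilator] at hcU
    push Not at hcU
    obtain ⟨w, hw⟩ := hcU
    obtain ⟨b, hb⟩ := IsSimpleModule.toSpanSingleton_surjective B hu w
    refine ⟨c * b * a, fun i hi => ?_, u, ?_⟩
    · rcases Nat.lt_succ_iff_lt_or_eq.1 hi with hi | rfl
      · exact Ideal.mul_mem_left _ _ (ha i hi)
      · exact Ideal.mul_mem_right _ _ (Ideal.mul_mem_right _ _ hc)
    · rw [mul_smul, mul_smul]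
      simp only [LinearMap.toSpanSingleton_apply] at hb
      rwa [hb]

theorem no_seq [IsArtinianRing B] (S : ℕ → Type)
    [∀ i, AddCommGroup (S i)] [∀ i, Module B (S i)] [∀ i, IsSimpleModule B (S i)]
    (hne : ∀ i n, IsEmpty (S i ≃ₗ[B] S (i + n + 1))) : False := by
  let G : ℕ → Submodule B B := fun k => ⨅ i : Fin k, Module.annihilator B (S i)
  have hG : ∀ k b, b ∈ G k ↔ ∀ i < k, b ∈ Module.annihilator B (S i) := by
    intro k b
    simp only [G, Submodule.mem_iInf]
    exact ⟨fun h i hi => h ⟨i, hi⟩, fun h i => h i.1 i.2⟩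
  let F : ℕ →o (Submodule B B)ᵒᵈ := ⟨fun k => OrderDual.toDual (G k), by
    intro a b hab
    refine OrderDual.toDual_le_toDual.2 fun x hx => ?_
    rw [hG] at hx ⊢
    exact fun i hi => hx i (by omega)⟩
  obtain ⟨k, hk⟩ := IsArtinian.monotone_stabilizes F
  have hk1 : G k = G (k + 1) := hk (k + 1) (by omega)
  obtain ⟨a, ha, u, hu⟩ := exists_mem_ann (B := B) (U := S k) S k
    (fun i hi => by
      obtain ⟨d, rfl⟩ := Nat.exists_eq_add_of_lt hi
      exact hne i d)
  have h1 : a ∈ G (k + 1) := hk1 ▸ (hG _ _).2 ha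
  exact hu (Module.mem_annihilator.1 ((hG _ _).1 h1 k (by omega)) u)

theorem kasch (R : Type) [CommRing R] [IsArtinianRing R] [Algebra R B] [Module.Finite R B]
    (hB : Module.Injective B B) (S : Type) [AddCommGroup S] [Module B S]
    [IsSimpleModule B S] : ∃ f : S →ₗ[B] B, Function.Injective f := by
  have := artinian (B := B) R
  obtain ⟨m0, hm0, ⟨e0⟩⟩ := isSimpleModule_iff_quot_maximal.1 ‹IsSimpleModule B S›
  by_contra hno
  let X := {m : Ideal B // IsSimpleModule B (B ⧸ m)}
  have : ∀ m : X, IsSimpleModule B (B ⧸ m.1) := fun m => m.2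
  choose x hx hs using fun m : X => exists_step R hB m.1
  let φ : X → X := fun m => ⟨_, hs m⟩
  obtain ⟨s, s_zero, s_succ⟩ : ∃ s : ℕ → X, (s 0).1 = m0 ∧ ∀ n, s (n + 1) = φ (s n) :=
    ⟨fun n => φ^[n] ⟨m0, isSimpleModule_iff_isCoatom.2 hm0.out⟩, rfl,
      fun n => Function.iterate_succ_apply' _ _ _⟩
  have h0 : ∀ n, IsEmpty ((B ⧸ (s 0).1) ≃ₗ[B] (B ⧸ (s (n + 1)).1)) := by
    intro n
    refine ⟨fun e => hno ?_⟩
    rw [s_succ, s_zero] at e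
    let k := (LinearMap.toSpanSingleton B B (x (s n))).quotKerEquivRange
    exact ⟨(Submodule.subtype _).comp (e0 ≪≫ₗ e ≪≫ₗ k).toLinearMap,
      (Submodule.subtype_injective _).comp (LinearEquiv.injective _)⟩
  have hne : ∀ i n, IsEmpty ((B ⧸ (s i).1) ≃ₗ[B] (B ⧸ (s (i + n + 1)).1)) := by
    intro i n
    induction i with
    | zero => rw [Nat.zero_add]; exact h0 n
    | succ i ih =>
      refine ⟨fun e => ?_⟩
      rw [show i + 1 + n + 1 = (i + n + 1) + 1 by ring, s_succ, s_succ] at e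
      exact ih.elim (step_inj hB _ _ _ _ (hx _) (hx _) e).some
  exact no_seq (fun i => B ⧸ (s i).1) hne

theorem baer_finsupp [IsNoetherianRing B] (hB : Module.Injective B B) (ι : Type) :
    Module.Injective B (ι →₀ B) := by
  classical
  apply Module.Baer.injective
  intro I g
  have hb := Module.Baer.of_injective hB
  obtain ⟨t, ht⟩ := (IsNoetherian.noetherian I : I.FG)
  -- finite support bound
  have hmem : ∀ x : t, x.1 ∈ I := fun x => ht ▸ Submodule.subset_span x.2
  let s : Finset ι := t.attach.biUnion fun x => (g ⟨x.1, hmem x⟩).support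
  have hs : ∀ (b : B) (hb : b ∈ I), ∀ i ∉ s, g ⟨b, hb⟩ i = 0 := by
    intro b hb i hi
    have hle : I ≤ (LinearMap.ker ((Finsupp.lapply i : (ι →₀ B) →ₗ[B] B).comp g)).map I.subtype := by
      refine ht.symm.le.trans (Submodule.span_le.2 ?_)
      intro y hy
      refine ⟨⟨y, hmem ⟨y, hy⟩⟩, ?_, rfl⟩
      by_contra hne
      apply hi
      refine Finset.mem_biUnion.2 ⟨⟨y, hy⟩, Finset.mem_attach _ _, ?_⟩
      simpa using hne
    obtain ⟨y, hy, hyb⟩ := hle hb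
    have : y = ⟨b, hb⟩ := Subtype.ext hyb
    rw [← this]
    simpa using hy
  choose G hG using fun i : ι => hb I ((Finsupp.lapply i : (ι →₀ B) →ₗ[B] B).comp g)
  refine ⟨∑ i ∈ s, (Finsupp.lsingle i).comp (G i), fun b hb => ?_⟩
  ext i
  simp only [LinearMap.sum_apply, LinearMap.comp_apply, hG _ b hb, Finsupp.lsingle_apply,
    Finsupp.lapply_apply, Finsupp.finsetSum_apply, Finsupp.single_apply]
  rw [Finset.sum_ite_eq']
  split_ifs with h
  · rfl
  · exact (hs b hb i h).symm

theorem embed (R : Type) [CommRing R] [IsArtinianRing R] [Algebra R B] [Module.Finite R B]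
    (hB : Module.Injective B B) (X : Type) [AddCommGroup X] [Module B X] :
    ∃ (ι : Type) (f : X →ₗ[B] (ι →₀ B)), Function.Injective f := by
  classical
  have := artinian (B := B) R
  let soc : Submodule B X := sSup {m | IsSimpleModule B m}
  have : IsSemisimpleModule B soc := by
    have := isSemisimpleModule_biSup_of_isSemisimpleModule_submodule (R := B) (M := X)
      (s := {m : Submodule B X | IsSimpleModule B m}) (p := id)
      (fun i hi => by
        have : IsSimpleModule B i := hi
        exact (inferInstance : IsSemisimpleModule B i))
    rw [show soc = ⨆ i ∈ {m : Submodule B X | IsSimpleModule B m}, id i from sSup_eq_iSup]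
    exact this
  obtain ⟨s, e, hind, hs⟩ := IsSemisimpleModule.exists_linearEquiv_dfinsupp B soc
  choose f hf using fun m : s => 
    have := hs m
    kasch R hB m.1
  let F := DFinsupp.mapRange.linearMap f
  have hF : Function.Injective F :=
    (DFinsupp.mapRange_injective (fun i => f i) (fun i => map_zero (f i))).2 hf
  let f2 : soc →ₗ[B] (s →₀ B) :=
    (finsuppLequivDFinsupp B).symm.toLinearMap.comp
      (F.comp e.toLinearMap)
  have hf2 : Function.Injective f2 := by
    exact (finsuppLequivDFinsupp B).symm.injective.comp (hF.comp e.injective)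
  obtain ⟨g, hg⟩ := (baer_finsupp hB s).out soc.subtype (Submodule.subtype_injective _) f2
  refine ⟨s, g, ?_⟩
  rw [← LinearMap.ker_eq_bot]
  by_contra hne
  obtain ⟨T, hT, hTs⟩ := exists_simple _ hne
  have := IsSimpleModule.nontrivial B T
  obtain ⟨⟨t, ht⟩, ht0⟩ := exists_ne (0 : T)
  have hts : t ∈ soc := (le_sSup (show T ∈ {m : Submodule B X | IsSimpleModule B m} from hTs)) ht
  have h1 : f2 ⟨t, hts⟩ = 0 := by rw [← hg]; exact hT ht
  have h2 := hf2 (h1.trans (map_zero f2).symm)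
  exact ht0 (Subtype.ext (show t = 0 from congrArg Subtype.val h2))

end
end QF

namespace QF
section
variable {B : Type} [Ring B]

theorem arrow_epi_left {f g : Arrow (ModuleCat.{0} B)} (sq : f ⟶ g) [Epi sq] : Epi sq.left where
  left_cancellation {Z} h k hk := by
    let z : Arrow (ModuleCat.{0} B) := Arrow.mk (0 : Z ⟶ Z)
    let h' : g ⟶ z := Arrow.homMk h 0 (by simp [z])
    let k' : g ⟶ z := Arrow.homMk k 0 (by simp [z])
    have : sq ≫ h' = sq ≫ k' := by
      ext1
      · simpa [h', k'] using hk
      · simp [h', k']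
    have := (cancel_epi sq).1 this
    exact congrArg CommaMorphism.left this

/-- The arrow `P ⟶ P ⊞ Q`. -/
noncomputable def stdArrow (P Q : ModuleCat.{0} B) : Arrow (ModuleCat.{0} B) :=
  Arrow.mk (biprod.inl : P ⟶ P ⊞ Q)

theorem stdArrow_projective (P Q : ModuleCat.{0} B) [Projective P] [Projective Q] :
    Projective (stdArrow P Q) where
  factors {E X} f e he := by
    have := arrow_epi_left e
    have : Epi e.right := inferInstance
    let p : P ⟶ E.left := Projective.factorThru (P := P) f.left e.left
    let q : Q ⟶ E.right := Projective.factorThru ((biprod.inr : Q ⟶ P ⊞ Q) ≫ f.right) e.right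
    have hp : p ≫ e.left = f.left := Projective.factorThru_comp _ _
    have hq : q ≫ e.right = (biprod.inr : Q ⟶ P ⊞ Q) ≫ f.right := Projective.factorThru_comp _ _
    refine ⟨Arrow.homMk p (biprod.desc (p ≫ E.hom) q) (biprod.inl_desc _ _).symm, ?_⟩
    ext1
    · exact hp
    · refine biprod.hom_ext' _ _ ?_ ?_
      · have h1 : (biprod.inl : P ⟶ P ⊞ Q) ≫ f.right = (p ≫ e.left) ≫ X.hom :=
          (Arrow.w f).symm.trans (congrArg (· ≫ X.hom) hp.symm)
        have h2 : e.left ≫ X.hom = E.hom ≫ e.right := Arrow.w e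
        change biprod.inl ≫ biprod.desc (p ≫ E.hom) q ≫ e.right = biprod.inl ≫ f.right
        rw [← Category.assoc, biprod.inl_desc, h1, Category.assoc, Category.assoc, h2]
      · change biprod.inr ≫ biprod.desc (p ≫ E.hom) q ≫ e.right = biprod.inr ≫ f.right
        rw [← Category.assoc, biprod.inr_desc, hq]

theorem mono_of_projective (f : Arrow (ModuleCat.{0} B)) [Projective f] : Mono f.hom := by
  let π : stdArrow f.left f.right ⟶ f := Arrow.homMk (𝟙 _) (biprod.desc f.hom (𝟙 _))
    (by simp [stdArrow])
  have : Epi π.left := (inferInstance : Epi (𝟙 f.left))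
  have : Epi π.right := by
    have h : biprod.inr ≫ (biprod.desc f.hom (𝟙 _)) = 𝟙 f.right := by simp
    have := epi_of_epi_fac h
    exact this
  have : Epi π := ⟨fun g h hgh => by
    ext1
    · exact (cancel_epi π.left).1 (congrArg CommaMorphism.left hgh)
    · exact (cancel_epi π.right).1 (congrArg CommaMorphism.right hgh)⟩
  let s := Projective.factorThru (𝟙 f) π
  have hs : s ≫ π = 𝟙 f := Projective.factorThru_comp _ _
  let sl : f.left ⟶ f.left := s.left
  have h1 : sl ≫ 𝟙 f.left = 𝟙 f.left := congrArg CommaMorphism.left hs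
  let sr : f.right ⟶ f.left ⊞ f.right := s.right
  have h2 : sl ≫ (biprod.inl : f.left ⟶ f.left ⊞ f.right) = f.hom ≫ sr := Arrow.w s
  have : Mono sl := by
    have : Mono (sl ≫ 𝟙 f.left) := by rw [h1]; infer_instance
    exact mono_of_mono sl (𝟙 f.left)
  have : Mono (f.hom ≫ sr) := by rw [← h2]; exact mono_comp _ _
  exact mono_of_mono f.hom sr

theorem mono_of_sub {f g : Arrow (ModuleCat.{0} B)} (i : f ⟶ g) [Mono i] [Projective g] :
    Mono f.hom := by
  have := mono_of_projective g
  have : Mono (f.hom ≫ i.right) := by rw [← Arrow.w i]; exact mono_comp _ _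
  exact mono_of_mono f.hom i.right

theorem sub_of_mono (R : Type) [CommRing R] [IsArtinianRing R] [Algebra R B] [Module.Finite R B]
    (hB : Module.Injective B B) (f : Arrow (ModuleCat.{0} B)) [Mono f.hom] :
    ∃ (g : Arrow (ModuleCat.{0} B)) (i : f ⟶ g), Projective g ∧ Mono i := by
  have := artinian (B := B) R
  obtain ⟨ι, α, hα⟩ := embed R hB f.left
  obtain ⟨κ, γ, hγ⟩ := embed R hB (cokernel f.hom : ModuleCat B)
  have : Injective (ModuleCat.of B (ι →₀ B)) :=
    (Module.injective_iff_injective_object _ _).1 (baer_finsupp hB ι)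
  have : Projective (ModuleCat.of B (ι →₀ B)) :=
    (IsProjective.iff_projective _).1 inferInstance
  have : Projective (ModuleCat.of B (κ →₀ B)) :=
    (IsProjective.iff_projective _).1 inferInstance
  let a : f.left ⟶ ModuleCat.of B (ι →₀ B) := ModuleCat.ofHom α
  let c : cokernel f.hom ⟶ ModuleCat.of B (κ →₀ B) := ModuleCat.ofHom γ
  have ha : Mono a := (ModuleCat.mono_iff_injective _).2 hα
  have hc : Mono c := (ModuleCat.mono_iff_injective _).2 hγ
  let b : f.right ⟶ ModuleCat.of B (ι →₀ B) := Injective.factorThru a f.hom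
  have hb : f.hom ≫ b = a := Injective.comp_factorThru _ _
  let r : f.right ⟶ ModuleCat.of B (ι →₀ B) ⊞ ModuleCat.of B (κ →₀ B) :=
    biprod.lift b (cokernel.π f.hom ≫ c)
  let i : f ⟶ stdArrow (ModuleCat.of B (ι →₀ B)) (ModuleCat.of B (κ →₀ B)) :=
    Arrow.homMk a r (by
      change a ≫ biprod.inl = f.hom ≫ r
      refine biprod.hom_ext _ _ ?_ ?_ <;> simp [r, hb])
  have hr : Mono r := by
    refine Preadditive.mono_of_cancel_zero _ fun {Z} g hg => ?_
    have h1 : g ≫ b = 0 := by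
      simpa [r] using congrArg (· ≫ biprod.fst) hg
    have h2 : g ≫ cokernel.π f.hom = 0 := by
      have : (g ≫ cokernel.π f.hom) ≫ c = 0 := by
        simpa [r] using congrArg (· ≫ biprod.snd) hg
      exact zero_of_comp_mono c this
    let l := Abelian.monoLift f.hom g h2
    have hl : l ≫ f.hom = g := Abelian.monoLift_comp _ _ _
    have : l ≫ a = 0 := by rw [← hb, ← Category.assoc, hl, h1]
    rw [← hl, zero_of_comp_mono a this, zero_comp]
  refine ⟨_, i, stdArrow_projective _ _, ⟨fun g h hgh => ?_⟩⟩
  ext1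
  · exact (cancel_mono a).1 (congrArg CommaMorphism.left hgh)
  · exact (cancel_mono r).1 (congrArg CommaMorphism.right hgh)

end
end QF

namespace QF
section
open MulOpposite
variable {A : Type} [Ring A]

theorem T2_zero (t : T2 A) : t.1 1 0 = 0 := t.2

/-- Underlying type of the `T₂(A)`-module of an arrow. -/
def GMod (f : Arrow (ModuleCat.{0} Aᵐᵒᵖ)) : Type := f.left × f.right

instance (f : Arrow (ModuleCat.{0} Aᵐᵒᵖ)) : AddCommGroup (GMod f) :=
  inferInstanceAs (AddCommGroup (f.left × f.right))

/-- The arrow as a linear map. -/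
def lm (f : Arrow (ModuleCat.{0} Aᵐᵒᵖ)) : f.left →ₗ[Aᵐᵒᵖ] f.right := f.hom.hom

/-- Entries of an element of the opposite triangular matrix ring. -/
def ent (l : (T2 A)ᵐᵒᵖ) (i j : Fin 2) : Aᵐᵒᵖ := op (l.unop.1 i j)

theorem ent_one (i j : Fin 2) : ent (1 : (T2 A)ᵐᵒᵖ) i j = if i = j then 1 else 0 := by
  simp only [ent, unop_one, Subring.coe_one, Matrix.one_apply]
  split_ifs <;> simp

theorem ent_zero (i j : Fin 2) : ent (0 : (T2 A)ᵐᵒᵖ) i j = 0 := by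
  simp [ent]

theorem ent_add (l m : (T2 A)ᵐᵒᵖ) (i j : Fin 2) : ent (l + m) i j = ent l i j + ent m i j := by
  simp [ent]

theorem ent_mul (l m : (T2 A)ᵐᵒᵖ) (i j : Fin 2) :
    ent (l * m) i j = ent l 0 j * ent m i 0 + ent l 1 j * ent m i 1 := by
  simp [ent, Matrix.mul_apply, Fin.sum_univ_two]

theorem ent_low (l : (T2 A)ᵐᵒᵖ) : ent l 1 0 = 0 := by
  simp [ent, T2_zero]

/-- Build an element from its entries. -/
def mkT (a b c : Aᵐᵒᵖ) : (T2 A)ᵐᵒᵖ := op ⟨!![a.unop, b.unop; 0, c.unop], rfl⟩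

@[simp] theorem mkT00 (a b c : Aᵐᵒᵖ) : ent (mkT a b c) 0 0 = a := rfl
@[simp] theorem mkT01 (a b c : Aᵐᵒᵖ) : ent (mkT a b c) 0 1 = b := rfl
@[simp] theorem mkT11 (a b c : Aᵐᵒᵖ) : ent (mkT a b c) 1 1 = c := rfl

theorem ent_ext {l m : (T2 A)ᵐᵒᵖ} (h0 : ent l 0 0 = ent m 0 0) (h1 : ent l 0 1 = ent m 0 1)
    (h2 : ent l 1 1 = ent m 1 1) : l = m := by
  apply unop_injective
  apply Subtype.ext
  ext i j
  fin_cases i <;> fin_cases j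
  · exact op_injective h0
  · exact op_injective h1
  · exact (T2_zero _).trans (T2_zero _).symm
  · exact op_injective h2

theorem mkT_mul (a b c a' b' c' : Aᵐᵒᵖ) :
    mkT a b c * mkT a' b' c' = mkT (a * a') (b * a' + c * b') (c * c') := by
  apply ent_ext <;> simp [ent_mul, ent_low]

theorem mkT_add (a b c a' b' c' : Aᵐᵒᵖ) :
    mkT a b c + mkT a' b' c' = mkT (a + a') (b + b') (c + c') := by
  apply ent_ext <;> simp [ent_add]

theorem mkT_one : (mkT 1 0 1 : (T2 A)ᵐᵒᵖ) = 1 := by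
  apply ent_ext <;> simp [ent_one]

theorem mkT_zero : (mkT 0 0 0 : (T2 A)ᵐᵒᵖ) = 0 := by
  apply ent_ext <;> simp [ent_zero]

theorem eq_mkT (l : (T2 A)ᵐᵒᵖ) : l = mkT (ent l 0 0) (ent l 0 1) (ent l 1 1) := by
  apply ent_ext <;> simp

instance (f : Arrow (ModuleCat.{0} Aᵐᵒᵖ)) : Module (T2 A)ᵐᵒᵖ (GMod f) where
  smul l p := (ent l 0 0 • p.1, ent l 0 1 • lm f p.1 + ent l 1 1 • p.2)
  one_smul p := by
    refine Prod.ext ?_ ?_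
    · change ent 1 0 0 • p.1 = p.1
      simp [ent_one]
    · change ent 1 0 1 • lm f p.1 + ent 1 1 1 • p.2 = p.2
      simp [ent_one]
  mul_smul l m p := by
    refine Prod.ext ?_ ?_
    · change ent (l * m) 0 0 • p.1 = ent l 0 0 • ent m 0 0 • p.1
      simp [ent_mul, ent_low, mul_smul]
    · change ent (l * m) 0 1 • lm f p.1 + ent (l * m) 1 1 • p.2 = 
        ent l 0 1 • lm f (ent m 0 0 • p.1) + 
          ent l 1 1 • (ent m 0 1 • lm f p.1 + ent m 1 1 • p.2)
      simp only [ent_mul, ent_low, mul_smul, add_smul, smul_add, map_smul, zero_smul, mul_zero,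
        zero_add, smul_zero]
      abel
  smul_zero l := by
    refine Prod.ext ?_ ?_
    · exact smul_zero _
    · change ent l 0 1 • lm f 0 + ent l 1 1 • (0 : f.right) = 0
      simp
  smul_add l p q := by
    refine Prod.ext ?_ ?_
    · exact smul_add _ _ _
    · change ent l 0 1 • lm f (p.1 + q.1) + ent l 1 1 • (p.2 + q.2) =
        (ent l 0 1 • lm f p.1 + ent l 1 1 • p.2) + (ent l 0 1 • lm f q.1 + ent l 1 1 • q.2)
      simp only [map_add, smul_add]
      abel
  add_smul l m p := by
    refine Prod.ext ?_ ?_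
    · change ent (l + m) 0 0 • p.1 = ent l 0 0 • p.1 + ent m 0 0 • p.1
      rw [ent_add, add_smul]
    · change ent (l + m) 0 1 • lm f p.1 + ent (l + m) 1 1 • p.2 =
        (ent l 0 1 • lm f p.1 + ent l 1 1 • p.2) + (ent m 0 1 • lm f p.1 + ent m 1 1 • p.2)
      simp only [ent_add, add_smul]
      abel
  zero_smul p := by
    refine Prod.ext ?_ ?_
    · change ent 0 0 0 • p.1 = 0
      rw [ent_zero, zero_smul]
    · change ent 0 0 1 • lm f p.1 + ent 0 1 1 • p.2 = 0
      simp [ent_zero]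

/-- Pairs as elements of the module. -/
def mkG (f : Arrow (ModuleCat.{0} Aᵐᵒᵖ)) (x : f.left) (y : f.right) : GMod f := (x, y)

theorem gsmul (f : Arrow (ModuleCat.{0} Aᵐᵒᵖ)) (a b c : Aᵐᵒᵖ) (x : f.left) (y : f.right) :
    mkT a b c • mkG f x y = mkG f (a • x) (b • lm f x + c • y) := rfl

theorem lm_comm {f g : Arrow (ModuleCat.{0} Aᵐᵒᵖ)} (sq : f ⟶ g) (x : f.left) :
    lm g (sq.left.hom x) = sq.right.hom (lm f x) := by
  have := Arrow.w sq
  exact LinearMap.congr_fun (congrArg ModuleCat.Hom.hom this) x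

/-- The functor from arrows to modules. -/
def G : Arrow (ModuleCat.{0} Aᵐᵒᵖ) ⥤ ModuleCat.{0} (T2 A)ᵐᵒᵖ where
  obj f := ModuleCat.of _ (GMod f)
  map {f g} sq := ModuleCat.ofHom
    { toFun := fun p => mkG g (sq.left.hom p.1) (sq.right.hom p.2)
      map_add' := fun p q => Prod.ext (map_add sq.left.hom p.1 q.1) (map_add sq.right.hom p.2 q.2)
      map_smul' := fun l p => by
        refine Prod.ext ?_ ?_
        · exact map_smul sq.left.hom (ent l 0 0) p.1
        · change sq.right.hom (ent l 0 1 • lm f p.1 + ent l 1 1 • p.2) =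
            ent l 0 1 • lm g (sq.left.hom p.1) + ent l 1 1 • sq.right.hom p.2
          rw [lm_comm, map_add, map_smul, map_smul] }
  map_id f := rfl
  map_comp f g := rfl

instance : (G (A := A)).Faithful where
  map_injective {f g} a b h := by
    have h : ∀ p : GMod f, mkG g (a.left.hom p.1) (a.right.hom p.2) =
      mkG g (b.left.hom p.1) (b.right.hom p.2) := fun p =>
        LinearMap.congr_fun (congrArg ModuleCat.Hom.hom h) p
    ext1
    · ext x
      exact congrArg Prod.fst (h (mkG f x 0))
    · ext y
      exact congrArg Prod.snd (h (mkG f 0 y))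

instance : (G (A := A)).Full where
  map_surjective {f g} φ := by
    let φ' : GMod f →ₗ[(T2 A)ᵐᵒᵖ] GMod g := φ.hom
    have key1 : ∀ x, φ' (mkG f x 0) = mkG g (φ' (mkG f x 0)).1 0 := by
      intro x
      have : mkG f x 0 = (mkT 1 0 0 : (T2 A)ᵐᵒᵖ) • mkG f x 0 := by rw [gsmul]; simp
      conv_lhs => rw [this, map_smul]
      refine (gsmul g 1 0 0 (φ' (mkG f x 0)).1 (φ' (mkG f x 0)).2).trans ?_
      simp
    have key2 : ∀ y, φ' (mkG f 0 y) = mkG g 0 (φ' (mkG f 0 y)).2 := by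
      intro x
      have : mkG f 0 x = (mkT 0 0 1 : (T2 A)ᵐᵒᵖ) • mkG f 0 x := by rw [gsmul]; simp
      conv_lhs => rw [this, map_smul]
      refine (gsmul g 0 0 1 (φ' (mkG f 0 x)).1 (φ' (mkG f 0 x)).2).trans ?_
      simp
    let u : f.left →ₗ[Aᵐᵒᵖ] g.left :=
      { toFun := fun x => (φ' (mkG f x 0)).1
        map_add' := fun x y => by
          have : mkG f (x + y) 0 = mkG f x 0 + mkG f y 0 :=
            Prod.ext rfl (add_zero (0 : f.right)).symm
          rw [this, map_add]; rfl
        map_smul' := fun a x => by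
          have : mkG f (a • x) 0 = (mkT a 0 a : (T2 A)ᵐᵒᵖ) • mkG f x 0 := by rw [gsmul]; simp
          rw [this, map_smul]; rfl }
    let v : f.right →ₗ[Aᵐᵒᵖ] g.right :=
      { toFun := fun x => (φ' (mkG f 0 x)).2
        map_add' := fun x y => by
          have : mkG f 0 (x + y) = mkG f 0 x + mkG f 0 y :=
            Prod.ext (add_zero (0 : f.left)).symm rfl
          rw [this, map_add]; rfl
        map_smul' := fun a x => by
          have : mkG f 0 (a • x) = (mkT a 0 a : (T2 A)ᵐᵒᵖ) • mkG f 0 x := by rw [gsmul]; simp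
          rw [this, map_smul, key2 x, gsmul]
          simp [mkG] }
    refine ⟨Arrow.homMk (ModuleCat.ofHom u) (ModuleCat.ofHom v) ?_, ?_⟩
    · ext x
      change lm g (φ' (mkG f x 0)).1 = (φ' (mkG f 0 (lm f x))).2
      have : mkG f 0 (lm f x) = (mkT 0 1 0 : (T2 A)ᵐᵒᵖ) • mkG f x 0 := by rw [gsmul]; simp
      rw [this, map_smul, key1 x, gsmul]
      simp [mkG]
    · refine ModuleCat.hom_ext (LinearMap.ext fun p => ?_)
      change mkG g (φ' (mkG f p.1 0)).1 (φ' (mkG f 0 p.2)).2 = φ' p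
      have : p = mkG f p.1 0 + mkG f 0 p.2 :=
        Prod.ext (add_zero (p.1 : f.left)).symm (zero_add (p.2 : f.right)).symm
      conv_rhs => rw [this, map_add, key1, key2]
      exact Prod.ext (add_zero _).symm (zero_add _).symm

/-- The diagonal embedding. -/
def diag : Aᵐᵒᵖ →+* (T2 A)ᵐᵒᵖ where
  toFun a := mkT a 0 a
  map_one' := mkT_one
  map_zero' := mkT_zero
  map_mul' a b := by rw [mkT_mul]; simp
  map_add' a b := by rw [mkT_add]; simp

theorem diag_apply (a : Aᵐᵒᵖ) : diag a = mkT a 0 a := rfl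

instance : (G (A := A)).EssSurj where
  mem_essImage M := by
    let _ : Module Aᵐᵒᵖ M := Module.compHom M diag
    have hs : ∀ (a : Aᵐᵒᵖ) (m : M), a • m = (mkT a 0 a : (T2 A)ᵐᵒᵖ) • m := fun _ _ => rfl
    let e (a b c : Aᵐᵒᵖ) (h : ∀ x, mkT a b c * diag x = diag x * mkT a b c) : M →ₗ[Aᵐᵒᵖ] M :=
      { toFun := fun m => mkT a b c • m
        map_add' := smul_add _
        map_smul' := fun x m => by
          rw [RingHom.id_apply, hs, hs, ← mul_smul, ← mul_smul, ← diag_apply, h] }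
    let X : Submodule Aᵐᵒᵖ M := LinearMap.ker (e 0 0 1 (fun x => by simp [diag_apply, mkT_mul]))
    let Y : Submodule Aᵐᵒᵖ M := LinearMap.ker (e 1 0 0 (fun x => by simp [diag_apply, mkT_mul]))
    have hX : ∀ m : M, m ∈ X ↔ (mkT 0 0 1 : (T2 A)ᵐᵒᵖ) • m = 0 := fun m => Iff.rfl
    have hY : ∀ m : M, m ∈ Y ↔ (mkT 1 0 0 : (T2 A)ᵐᵒᵖ) • m = 0 := fun m => Iff.rfl
    have hsum : ∀ m : M, (mkT 1 0 0 : (T2 A)ᵐᵒᵖ) • m + (mkT 0 0 1 : (T2 A)ᵐᵒᵖ) • m = m := by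
      intro m
      rw [← add_smul, mkT_add]
      simp [mkT_one]
    let n : X →ₗ[Aᵐᵒᵖ] Y := LinearMap.codRestrict Y
      ((e 0 1 0 (fun x => by simp [diag_apply, mkT_mul])).comp X.subtype) (fun x => by
        rw [hY]
        change (mkT 1 0 0 : (T2 A)ᵐᵒᵖ) • (mkT 0 1 0 : (T2 A)ᵐᵒᵖ) • (x : M) = 0
        rw [← mul_smul, mkT_mul]
        simp [mkT_zero])
    have hn : ∀ x : X, ((n x : Y) : M) = (mkT 0 1 0 : (T2 A)ᵐᵒᵖ) • (x : M) := fun _ => rfl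
    let f : Arrow (ModuleCat.{0} Aᵐᵒᵖ) := Arrow.mk (ModuleCat.ofHom n)
    let ψ : GMod f →ₗ[(T2 A)ᵐᵒᵖ] M :=
      { toFun := fun p => ((show X from p.1) : M) + ((show Y from p.2) : M)
        map_add' := fun p q => by
          change ((show X from p.1) : M) + ((show X from q.1) : M) +
            (((show Y from p.2) : M) + ((show Y from q.2) : M)) = _
          abel
        map_smul' := fun l p => by
          obtain ⟨x, y⟩ := p
          change X at x
          change Y at y
          change ((ent l 0 0 • x : X) : M) + ((ent l 0 1 • n x + ent l 1 1 • y : Y) : M) =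
            l • ((x : M) + (y : M))
          have hx : (mkT 1 0 0 : (T2 A)ᵐᵒᵖ) • (x : M) = x := by
            have := hsum x
            rwa [(hX _).1 x.2, add_zero] at this
          have hy : (mkT 0 0 1 : (T2 A)ᵐᵒᵖ) • (y : M) = y := by
            have := hsum y
            rwa [(hY _).1 y.2, zero_add] at this
          rw [Submodule.coe_smul, Submodule.coe_add, Submodule.coe_smul, Submodule.coe_smul, hn,
            smul_add, hs, hs, hs]
          conv_rhs => rw [← hx, ← hy]
          conv_lhs => rw [← hx, ← hy]
          rw [eq_mkT l]
          simp only [← mul_smul, mkT_mul, mkT00, mkT01, mkT11]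
          rw [← add_assoc, ← add_smul, mkT_add]
          simp }
    have hψ : ∀ (x : X) (y : Y), ψ (mkG f x y) = (x : M) + (y : M) := fun _ _ => rfl
    have hbij : Function.Bijective ψ := by
      constructor
      · rw [injective_iff_map_eq_zero]
        rintro ⟨x, y⟩ h
        change X at x
        change Y at y
        have h : (x : M) + (y : M) = 0 := h
        have h1 := congrArg ((mkT 1 0 0 : (T2 A)ᵐᵒᵖ) • ·) h
        have h2 := congrArg ((mkT 0 0 1 : (T2 A)ᵐᵒᵖ) • ·) h
        simp only [smul_add, smul_zero, (hX _).1 x.2, (hY _).1 y.2, add_zero, zero_add] at h1 h2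
        have hx := hsum x
        have hy := hsum y
        rw [h1, (hX _).1 x.2, add_zero] at hx
        rw [h2, (hY _).1 y.2, add_zero] at hy
        exact Prod.ext (Subtype.ext hx.symm) (Subtype.ext hy.symm)
      · intro m
        refine ⟨mkG f (⟨(mkT 1 0 0 : (T2 A)ᵐᵒᵖ) • m, ?_⟩ : X)
          (⟨(mkT 0 0 1 : (T2 A)ᵐᵒᵖ) • m, ?_⟩ : Y), hsum m⟩
        · rw [hX, ← mul_smul, mkT_mul]; simp [mkT_zero]
        · rw [hY, ← mul_smul, mkT_mul]; simp [mkT_zero]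
    exact ⟨f, ⟨(LinearEquiv.ofBijective ψ hbij).toModuleIso⟩⟩

instance : (G (A := A)).IsEquivalence where

/-- The regular module corresponds to the standard arrow. -/
theorem regular : Nonempty (ModuleCat.of (T2 A)ᵐᵒᵖ (T2 A)ᵐᵒᵖ ≅
    G.obj (Arrow.mk (ModuleCat.ofHom (LinearMap.inr Aᵐᵒᵖ Aᵐᵒᵖ Aᵐᵒᵖ)))) := by
  let f : Arrow (ModuleCat.{0} Aᵐᵒᵖ) :=
    Arrow.mk (ModuleCat.ofHom (LinearMap.inr Aᵐᵒᵖ Aᵐᵒᵖ Aᵐᵒᵖ))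
  let ψ : (T2 A)ᵐᵒᵖ →ₗ[(T2 A)ᵐᵒᵖ] GMod f :=
    { toFun := fun l => ((ent l 0 0 : Aᵐᵒᵖ), ((ent l 1 1, ent l 0 1) : Aᵐᵒᵖ × Aᵐᵒᵖ))
      map_add' := fun l m => by simp only [ent_add]; rfl
      map_smul' := fun l m => by
        refine Prod.ext ?_ ?_
        · change ent (l * m) 0 0 = ent l 0 0 * ent m 0 0
          simp [ent_mul, ent_low]
        · change ((ent (l * m) 1 1, ent (l * m) 0 1) : Aᵐᵒᵖ × Aᵐᵒᵖ) =
            ent l 0 1 • ((0, ent m 0 0) : Aᵐᵒᵖ × Aᵐᵒᵖ) + ent l 1 1 • (ent m 1 1, ent m 0 1)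
          ext1 <;> simp [ent_mul, ent_low] }
  have hψ : Function.Bijective ψ := by
    constructor
    · intro l m h
      exact ent_ext (congrArg Prod.fst h) (congrArg (fun p : GMod f => (p.2 : Aᵐᵒᵖ × Aᵐᵒᵖ).2) h)
        (congrArg (fun p : GMod f => (p.2 : Aᵐᵒᵖ × Aᵐᵒᵖ).1) h)
    · rintro ⟨x, y⟩
      exact ⟨mkT x (y : Aᵐᵒᵖ × Aᵐᵒᵖ).2 (y : Aᵐᵒᵖ × Aᵐᵒᵖ).1, rfl⟩
  exact ⟨(LinearEquiv.ofBijective ψ hψ).toModuleIso⟩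

theorem inr_iso : Nonempty (Arrow.mk (ModuleCat.ofHom (LinearMap.inr Aᵐᵒᵖ Aᵐᵒᵖ Aᵐᵒᵖ)) ≅
      Arrow.mk (biprod.inr : ModuleCat.of Aᵐᵒᵖ Aᵐᵒᵖ ⟶
          ModuleCat.of Aᵐᵒᵖ Aᵐᵒᵖ ⊞ ModuleCat.of Aᵐᵒᵖ Aᵐᵒᵖ)) := by
  refine ⟨Arrow.isoMk (Iso.refl _) (ModuleCat.biprodIsoProd
    (ModuleCat.of Aᵐᵒᵖ Aᵐᵒᵖ) (ModuleCat.of Aᵐᵒᵖ Aᵐᵒᵖ)).symm ?_⟩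
  change 𝟙 _ ≫ biprod.inr = ModuleCat.ofHom (LinearMap.inr Aᵐᵒᵖ Aᵐᵒᵖ Aᵐᵒᵖ) ≫
    (ModuleCat.biprodIsoProd (ModuleCat.of Aᵐᵒᵖ Aᵐᵒᵖ) (ModuleCat.of Aᵐᵒᵖ Aᵐᵒᵖ)).inv
  refine biprod.hom_ext _ _ ?_ ?_
  · rw [Category.assoc, Category.assoc, ModuleCat.biprodIsoProd_inv_comp_fst, biprod.inr_fst]
    ext; simp
  · rw [Category.assoc, Category.assoc, ModuleCat.biprodIsoProd_inv_comp_snd, biprod.inr_snd]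
    ext; simp

end
end QF

/-- Let `A` be a self-injective artin algebra. Under the standard
equivalence `mod T₂(A) ≃ Mor(mod A)` (any equivalence sending the regular
module to the arrow `biprod.inr : A ⟶ A ⊞ A`), the torsionless `T₂(A)`-modules
correspond exactly to the monomorphisms of `A`-modules. -/
theorem stmt16 (R : Type) [CommRing R] [IsArtinianRing R]
    (A : Type) [Ring A] [Algebra R A] [Module.Finite R A]
    (hsi : Injective (ModuleCat.of Aᵐᵒᵖ Aᵐᵒᵖ)) :
    ∃ E : ModuleCat.{0} ((T2 A)ᵐᵒᵖ) ≌ Arrow (ModuleCat.{0} Aᵐᵒᵖ),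
      Nonempty (E.functor.obj (ModuleCat.of ((T2 A)ᵐᵒᵖ) ((T2 A)ᵐᵒᵖ)) ≅
        Arrow.mk (biprod.inr : ModuleCat.of Aᵐᵒᵖ Aᵐᵒᵖ ⟶
          ModuleCat.of Aᵐᵒᵖ Aᵐᵒᵖ ⊞ ModuleCat.of Aᵐᵒᵖ Aᵐᵒᵖ)) ∧
      ∀ M : ModuleCat.{0} ((T2 A)ᵐᵒᵖ),
        Torsionless M ↔ Mono (E.functor.obj M).hom := by
  have hB : Module.Injective Aᵐᵒᵖ Aᵐᵒᵖ := (Module.injective_iff_injective_object _ _).2 hsi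
  have hfin : Module.Finite R Aᵐᵒᵖ := Module.Finite.equiv (MulOpposite.opLinearEquiv R)
  let E := (QF.G (A := A)).asEquivalence.symm
  obtain ⟨e1⟩ := QF.regular (A := A)
  obtain ⟨e2⟩ := QF.inr_iso (A := A)
  refine ⟨E, ⟨E.functor.mapIso (e1 ≪≫ QF.G.mapIso e2) ≪≫ E.counitIso.app _⟩, fun M => ⟨?_, ?_⟩⟩
  · rintro ⟨Q, f, hQ, hf⟩
    have : Projective (E.functor.obj Q) := (E.map_projective_iff Q).2 hQ
    have : Mono (E.functor.map f) := inferInstance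
    exact QF.mono_of_sub (E.functor.map f)
  · intro h
    obtain ⟨g, i, hg, hi⟩ := QF.sub_of_mono R hB (E.functor.obj M)
    refine ⟨E.inverse.obj g, E.unitIso.hom.app M ≫ E.inverse.map i,
      (E.symm.map_projective_iff g).2 hg, ?_⟩
    have : Mono (E.inverse.map i) := inferInstance
    exact mono_comp _ _
end
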